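/- In the even Clifford algebra A of the quadratic form diag(1,1,0) on ℂ³, the ℂ-linear span I of {y, z} is a two-sided ideal of A satisfying a·b = 0 for all a, b ∈ I (so I² = 0), and I equals the Jacobson radical of A, i.e. the intersection of all maximal left ideals of A. -/

import Mathlib

open CliffordAlgebra

noncomputable section

/-- The quadratic form `v ↦ v₀² + v₁²` on `ℂ³`, with Gram matrix `diag(1,1,0)` —
the quadratic form of a corank-1 degenerate conic. -/
def Q : QuadraticForm ℂ (Fin 3 → ℂ) := QuadraticMap.weightedSumSquares ℂ ![1, 1, 0]

/-- The standard basis vectors `e₁, e₂, e₃` of `ℂ³` (indexed by `0, 1, 2`). -/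
def e (j : Fin 3) : Fin 3 → ℂ := Pi.single j 1

/-- `x = i·ι(e₁)·ι(e₂)` in the Clifford algebra of `Q`. -/
def x : CliffordAlgebra Q := Complex.I • (ι Q (e 0) * ι Q (e 1))

/-- `y = i·ι(e₂)·ι(e₃)` in the Clifford algebra of `Q`. -/
def y : CliffordAlgebra Q := Complex.I • (ι Q (e 1) * ι Q (e 2))

/-- `z = ι(e₁)·ι(e₃)` in the Clifford algebra of `Q`. -/
def z : CliffordAlgebra Q := ι Q (e 0) * ι Q (e 2)

lemma x_mem : x ∈ even Q := Subalgebra.smul_mem _ (ι_mul_ι_mem_evenOdd_zero Q _ _) _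

lemma y_mem : y ∈ even Q := Subalgebra.smul_mem _ (ι_mul_ι_mem_evenOdd_zero Q _ _) _

lemma z_mem : z ∈ even Q := ι_mul_ι_mem_evenOdd_zero Q _ _

/-- `x` as an element of the even Clifford algebra `A = CliffordAlgebra.even Q`. -/
def xA : even Q := ⟨x, x_mem⟩

/-- `y` as an element of the even Clifford algebra `A = CliffordAlgebra.even Q`. -/
def yA : even Q := ⟨y, y_mem⟩

/-- `z` as an element of the even Clifford algebra `A = CliffordAlgebra.even Q`. -/
def zA : even Q := ⟨z, z_mem⟩

/-- The `ℂ`-linear span of `{y, z}` inside the even Clifford algebra `A`. -/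
def Irad : Submodule ℂ (even Q) := Submodule.span ℂ {yA, zA}

lemma ι_e_sq (j : Fin 3) :
    ι Q (e j) * ι Q (e j) = algebraMap ℂ _ ((![1, 1, 0] : Fin 3 → ℂ) j) := by
  rw [ι_sq_scalar]
  congr 1
  fin_cases j <;> simp [Q, e, QuadraticMap.weightedSumSquares_apply, Fin.sum_univ_three]

lemma ι_e_anticomm {j k : Fin 3} (h : j ≠ k) :
    ι Q (e j) * ι Q (e k) = -(ι Q (e k) * ι Q (e j)) := by
  have hpolar : QuadraticMap.polar Q (e j) (e k) = 0 := by
    fin_cases j <;> fin_cases k <;>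
      simp_all [QuadraticMap.polar, Q, e, QuadraticMap.weightedSumSquares_apply,
        Fin.sum_univ_three]
  rw [eq_neg_iff_add_eq_zero, ι_mul_ι_add_swap, hpolar, map_zero]

/-- The multiplication table of `x, y, z`. -/
lemma mul_table :
    x * x = 1 ∧ x * y = -z ∧ x * z = -y ∧ y * x = z ∧ z * x = y ∧
      y * y = 0 ∧ y * z = 0 ∧ z * y = 0 ∧ z * z = 0 := by
  have h0 : ι Q (e 0) * ι Q (e 0) = 1 := by simpa using ι_e_sq 0
  have h1 : ι Q (e 1) * ι Q (e 1) = 1 := by simpa using ι_e_sq 1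
  have h2 : ι Q (e 2) * ι Q (e 2) = 0 := by simpa using ι_e_sq 2
  have h10 := ι_e_anticomm (show (1 : Fin 3) ≠ 0 by decide)
  have h20 := ι_e_anticomm (show (2 : Fin 3) ≠ 0 by decide)
  have h21 := ι_e_anticomm (show (2 : Fin 3) ≠ 1 by decide)
  unfold x y z
  generalize ι Q (e 0) = a at *
  generalize ι Q (e 1) = b at *
  generalize ι Q (e 2) = c at *
  have a0 (t) : a * (a * t) = t := by rw [← mul_assoc, h0, one_mul]
  have a1 (t) : b * (b * t) = t := by rw [← mul_assoc, h1, one_mul]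
  have a10 (t) : b * (a * t) = -(a * (b * t)) := by rw [← mul_assoc, h10, neg_mul, mul_assoc]
  have a20 (t) : c * (a * t) = -(a * (c * t)) := by rw [← mul_assoc, h20, neg_mul, mul_assoc]
  have a21 (t) : c * (b * t) = -(b * (c * t)) := by rw [← mul_assoc, h21, neg_mul, mul_assoc]
  refine ⟨?_, ?_, ?_, ?_, ?_, ?_, ?_, ?_, ?_⟩ <;>
    simp [mul_assoc, smul_smul, h0, h1, h2, h21, a0, a1, a10, a20, a21]

lemma xA_mul_xA : xA * xA = 1 := Subtype.ext mul_table.1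
lemma xA_mul_yA : xA * yA = -zA := Subtype.ext mul_table.2.1
lemma xA_mul_zA : xA * zA = -yA := Subtype.ext mul_table.2.2.1
lemma yA_mul_xA : yA * xA = zA := Subtype.ext mul_table.2.2.2.1
lemma zA_mul_xA : zA * xA = yA := Subtype.ext mul_table.2.2.2.2.1
lemma yA_mul_yA : yA * yA = 0 := Subtype.ext mul_table.2.2.2.2.2.1
lemma yA_mul_zA : yA * zA = 0 := Subtype.ext mul_table.2.2.2.2.2.2.1
lemma zA_mul_yA : zA * yA = 0 := Subtype.ext mul_table.2.2.2.2.2.2.2.1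
lemma zA_mul_zA : zA * zA = 0 := Subtype.ext mul_table.2.2.2.2.2.2.2.2

lemma mem_Irad {a : even Q} : a ∈ Irad ↔ ∃ r s : ℂ, r • yA + s • zA = a :=
  Submodule.mem_span_pair

lemma ι_eq_sum (u : Fin 3 → ℂ) :
    ι Q u = u 0 • ι Q (e 0) + u 1 • ι Q (e 1) + u 2 • ι Q (e 2) := by
  simp only [← map_smul, ← map_add]
  congr 1
  ext j
  fin_cases j <;> simp [e]

lemma ι_mul_ι_eq (u v : Fin 3 → ℂ) :
    ι Q u * ι Q v = (u 0 * v 0 + u 1 * v 1) • 1 + (-Complex.I * (u 0 * v 1 - u 1 * v 0)) • x +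
      (-Complex.I * (u 1 * v 2 - u 2 * v 1)) • y + (u 0 * v 2 - u 2 * v 0) • z := by
  have h0 : ι Q (e 0) * ι Q (e 0) = 1 := by simpa using ι_e_sq 0
  have h1 : ι Q (e 1) * ι Q (e 1) = 1 := by simpa using ι_e_sq 1
  have h2 : ι Q (e 2) * ι Q (e 2) = 0 := by simpa using ι_e_sq 2
  have h10 := ι_e_anticomm (show (1 : Fin 3) ≠ 0 by decide)
  have h20 := ι_e_anticomm (show (2 : Fin 3) ≠ 0 by decide)
  have h21 := ι_e_anticomm (show (2 : Fin 3) ≠ 1 by decide)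
  have hI (t : ℂ) : -Complex.I * t * Complex.I = t := by
    linear_combination (-t) * Complex.I_mul_I
  rw [ι_eq_sum u, ι_eq_sum v]
  simp only [x, y, z, smul_smul, hI, mul_add, add_mul, smul_mul_smul_comm,
    h0, h1, h2, h10, h20, h21]
  module

lemma exists_eq_combination (a : even Q) :
    ∃ p q r s : ℂ, a = p • 1 + q • xA + (r • yA + s • zA) := by
  obtain ⟨a, ha⟩ := a
  induction a, ha using even_induction with
  | algebraMap t => exact ⟨t, 0, 0, 0, Subtype.ext (by simp [Algebra.algebraMap_eq_smul_one])⟩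
  | add a b ha hb iha ihb =>
    obtain ⟨p, q, r, s, h⟩ := iha
    obtain ⟨p', q', r', s', h'⟩ := ihb
    refine ⟨p + p', q + q', r + r', s + s',
      (congrArg₂ (· + ·) h h').trans ?_⟩
    module
  | ι_mul_ι_mul u v a ha ih =>
    obtain ⟨p, q, r, s, h⟩ := ih
    have key : (⟨ι Q u * ι Q v * a, mul_mem (ι_mul_ι_mem_evenOdd_zero Q u v) ha⟩ : even Q) =
        ((u 0 * v 0 + u 1 * v 1) • 1 + (-Complex.I * (u 0 * v 1 - u 1 * v 0)) • xA +
        (-Complex.I * (u 1 * v 2 - u 2 * v 1)) • yA + (u 0 * v 2 - u 2 * v 0) • zA) *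
        (⟨a, ha⟩ : even Q) :=
      Subtype.ext (congrArg (· * a) (ι_mul_ι_eq u v))
    rw [h] at key
    generalize u 0 * v 0 + u 1 * v 1 = p' at key
    generalize -Complex.I * (u 0 * v 1 - u 1 * v 0) = q' at key
    generalize -Complex.I * (u 1 * v 2 - u 2 * v 1) = r' at key
    generalize u 0 * v 2 - u 2 * v 0 = s' at key
    refine ⟨p' * p + q' * q, p' * q + q' * p, p' * r + r' * p - q' * s + s' * q,
      p' * s + s' * p - q' * r + r' * q, key.trans ?_⟩
    simp only [mul_add, add_mul, smul_mul_smul_comm, one_mul, mul_one, xA_mul_xA, xA_mul_yA,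
      xA_mul_zA, yA_mul_xA, zA_mul_xA, yA_mul_yA, yA_mul_zA, zA_mul_yA, zA_mul_zA]
    module

lemma mul_mem_Irad (a : even Q) {b : even Q} (hb : b ∈ Irad) : a * b ∈ Irad := by
  obtain ⟨p, q, r, s, rfl⟩ := exists_eq_combination a
  obtain ⟨r', s', rfl⟩ := mem_Irad.1 hb
  refine mem_Irad.2 ⟨p * r' - q * s', p * s' - q * r', ?_⟩
  simp only [mul_add, add_mul, smul_mul_smul_comm, one_mul, xA_mul_yA,
    xA_mul_zA, yA_mul_yA, yA_mul_zA, zA_mul_yA, zA_mul_zA]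
  module

lemma Irad_mul_mem (a : even Q) {b : even Q} (hb : b ∈ Irad) : b * a ∈ Irad := by
  obtain ⟨p, q, r, s, rfl⟩ := exists_eq_combination a
  obtain ⟨r', s', rfl⟩ := mem_Irad.1 hb
  refine mem_Irad.2 ⟨p * r' + q * s', p * s' + q * r', ?_⟩
  simp only [mul_add, add_mul, smul_mul_smul_comm, mul_one, yA_mul_xA,
    zA_mul_xA, yA_mul_yA, yA_mul_zA, zA_mul_yA, zA_mul_zA]
  module

lemma mul_eq_zero_of_mem_Irad {a b : even Q} (ha : a ∈ Irad) (hb : b ∈ Irad) : a * b = 0 := by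
  obtain ⟨r, s, rfl⟩ := mem_Irad.1 ha
  obtain ⟨r', s', rfl⟩ := mem_Irad.1 hb
  simp [mul_add, add_mul, yA_mul_yA, yA_mul_zA, zA_mul_yA, zA_mul_zA]

/-- For `c² = -1`, the even map `(u, v) ↦ (u₀ - c u₁)(v₀ + c v₁)`, sending `(e₁, e₂)` to `c`. -/
def evenHomOfSq (c : ℂ) (hc : c * c = -1) : EvenHom Q ℂ where
  bilin := LinearMap.mk₂ ℂ (fun u v => (u 0 - c * u 1) * (v 0 + c * v 1))
    (fun _ _ _ => by simp only [Pi.add_apply]; ring)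
    (fun _ _ _ => by simp only [Pi.smul_apply, smul_eq_mul]; ring)
    (fun _ _ _ => by simp only [Pi.add_apply]; ring)
    (fun _ _ _ => by simp only [Pi.smul_apply, smul_eq_mul]; ring)
  contract m := by
    simp [Q, QuadraticMap.weightedSumSquares_apply, Fin.sum_univ_three]
    linear_combination (-m 1 * m 1) * hc
  contract_mid u v w := by
    simp [Q, QuadraticMap.weightedSumSquares_apply, Fin.sum_univ_three]
    linear_combination (-v 1 * v 1 * (u 0 - c * u 1) * (w 0 + c * w 1)) * hc

/-- The character of the even Clifford algebra sending `ι e₁ * ι e₂` to a square root of `-1`. -/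
def character (c : ℂ) (hc : c * c = -1) : even Q →ₐ[ℂ] ℂ := even.lift Q (evenHomOfSq c hc)

lemma character_apply (c : ℂ) (hc : c * c = -1) (p q r s : ℂ) :
    character c hc (p • 1 + q • xA + (r • yA + s • zA)) = p + q * (Complex.I * c) := by
  have hx : xA = Complex.I • (even.ι Q).bilin (e 0) (e 1) := rfl
  have hy : yA = Complex.I • (even.ι Q).bilin (e 1) (e 2) := rfl
  have hz : zA = (even.ι Q).bilin (e 0) (e 2) := rfl
  simp [character, hx, hy, hz, even.lift_ι, evenHomOfSq, e]

lemma character_eq_zero_of_mem (c : ℂ) (hc : c * c = -1) {a : even Q}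
    (ha : a ∈ (sInf {J : Ideal (even Q) | J.IsMaximal} : Ideal (even Q))) :
    character c hc a = 0 := by
  have hsurj : Function.Surjective (character c hc) := fun t =>
    ⟨algebraMap ℂ _ t, by simp⟩
  exact (Submodule.mem_sInf.1 ha) _ (RingHom.ker_isMaximal_of_surjective (character c hc) hsurj)

/-- In the even Clifford algebra `A` of `diag(1,1,0)` on `ℂ³`, the `ℂ`-linear
span `I` of `{y, z}` is a two-sided ideal of `A` satisfying `a·b = 0` for all `a, b ∈ I`
(so `I² = 0`), and `I` equals the Jacobson radical of `A`, i.e. the intersection of all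
maximal left ideals of `A`. -/
theorem span_y_z_is_radical :
    (∀ a : even Q, ∀ b ∈ Irad, a * b ∈ Irad ∧ b * a ∈ Irad) ∧
    (∀ a ∈ Irad, ∀ b ∈ Irad, a * b = 0) ∧
    (Irad : Set (even Q)) = (sInf {J : Ideal (even Q) | J.IsMaximal} : Ideal (even Q)) := by
  refine ⟨fun a b hb => ⟨mul_mem_Irad a hb, Irad_mul_mem a hb⟩,
    fun a ha b hb => mul_eq_zero_of_mem_Irad ha hb, ?_⟩
  ext a
  simp only [SetLike.mem_coe]
  constructor
  · intro ha
    have hjac : a ∈ Ideal.jacobson (⊥ : Ideal (even Q)) := by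
      refine Ideal.mem_jacobson_iff.2 fun b => ⟨1 - b * a, ?_⟩
      have hba := mul_mem_Irad b ha
      rw [Ideal.mem_bot, mul_assoc, sub_mul, mul_eq_zero_of_mem_Irad hba hba]
      simp
    simpa [Ideal.jacobson] using hjac
  · intro ha
    have h₁ := character_eq_zero_of_mem Complex.I Complex.I_mul_I ha
    have h₂ := character_eq_zero_of_mem (-Complex.I) (by simp) ha
    obtain ⟨p, q, r, s, rfl⟩ := exists_eq_combination a
    rw [character_apply] at h₁ h₂
    simp only [mul_neg, Complex.I_mul_I, neg_neg, mul_one] at h₁ h₂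
    have hp : p = 0 := by linear_combination (h₁ + h₂) / 2
    have hq : q = 0 := by linear_combination (h₂ - h₁) / 2
    exact mem_Irad.2 ⟨r, s, by simp [hp, hq]⟩
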